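/- arXiv:2209.12483 — 4 statements merged into one kernel-verified Lean document; each statement's English description precedes it below -/
import Mathlib

section
/- Let n ≥ 1, let M be an n×n real matrix with nonnegative entries whose rows each sum to 1, let ρ ∈ ℝ^n, and let γ_0, ..., γ_D ∈ (0,1). For each d ∈ {0,...,D} define V_d := Σ_{t=0}^∞ Φ_d(t) M^t ρ (these series converge absolutely). Then the affine map T : ℝ^n → ℝ^n defined by T(q) := ρ + Σ_{d=0}^{D-1} γ_d M V_d + γ_D M q is a contraction with Lipschitz constant γ_D with respect to the supremum norm on ℝ^n, and V_D is its unique fixed point. -/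
/-- `Phi γ d t = Σ_{(a_0,...,a_d) ∈ ℕ^{d+1}, a_0+...+a_d = t} ∏_{i=0}^{d} γ_i^{a_i}`. -/
noncomputable def Phi (γ : ℕ → ℝ) (d t : ℕ) : ℝ :=
  ∑ a ∈ Finset.Nat.antidiagonalTuple (d + 1) t, ∏ i : Fin (d + 1), γ i ^ a i

theorem Phi_zero_left (γ : ℕ → ℝ) (t : ℕ) : Phi γ 0 t = γ 0 ^ t := by
  simp [Phi]

theorem Phi_zero_right (γ : ℕ → ℝ) (d : ℕ) : Phi γ d 0 = 1 := by
  simp [Phi, Finset.Nat.antidiagonalTuple_zero_right]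

/-- Splitting off the last discount factor expresses `Phi` as a Cauchy product. -/
theorem Phi_succ_left (γ : ℕ → ℝ) (d t : ℕ) :
    Phi γ (d + 1) t = ∑ p ∈ Finset.HasAntidiagonal.antidiagonal t, Phi γ d p.1 * γ (d + 1) ^ p.2 := by
  simp only [Phi, Finset.sum_mul]
  rw [Finset.sum_sigma']
  refine Finset.sum_bij'
    (fun a _ => (⟨(∑ i, Fin.init a i, a (Fin.last _)), Fin.init a⟩ :
      Σ _ : ℕ × ℕ, Fin (d + 1) → ℕ))
    (fun x _ => Fin.snoc (α := fun _ => ℕ) x.2 x.1.2) ?_ ?_ ?_ ?_ ?_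
  · intro a ha
    rw [Finset.Nat.mem_antidiagonalTuple, Fin.sum_univ_castSucc] at ha
    simpa [Finset.Nat.mem_antidiagonalTuple, Fin.init] using ha
  · rintro ⟨⟨k, l⟩, b⟩ hb
    simp only [Finset.mem_sigma, Finset.HasAntidiagonal.mem_antidiagonal,
      Finset.Nat.mem_antidiagonalTuple] at hb
    rw [Finset.Nat.mem_antidiagonalTuple, Fin.sum_univ_castSucc]
    simp [hb.1, hb.2]
  · intro a _
    exact Fin.snoc_init_self a
  · rintro ⟨⟨k, l⟩, b⟩ hb
    simp only [Finset.mem_sigma, Finset.HasAntidiagonal.mem_antidiagonal,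
      Finset.Nat.mem_antidiagonalTuple] at hb
    simp [hb.2]
  · intro a _
    rw [Fin.prod_univ_castSucc]
    simp [Fin.init]

theorem Phi_succ_succ (γ : ℕ → ℝ) (d t : ℕ) :
    Phi γ (d + 1) (t + 1) = Phi γ d (t + 1) + γ (d + 1) * Phi γ (d + 1) t := by
  rw [Phi_succ_left, Phi_succ_left, Finset.Nat.sum_antidiagonal_succ', Finset.mul_sum]
  congr 1
  · simp
  · exact Finset.sum_congr rfl fun p _ => by ring

theorem Phi_succ_right (γ : ℕ → ℝ) (d t : ℕ) :
    Phi γ d (t + 1) = ∑ k ∈ Finset.range (d + 1), γ k * Phi γ k t := by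
  induction d with
  | zero => simp [Phi_zero_left, pow_succ']
  | succ d ih => rw [Phi_succ_succ, ih, Finset.sum_range_succ _ (d + 1)]

theorem summable_norm_Phi (γ : ℕ → ℝ) (d : ℕ) (hγ : ∀ k ≤ d, ‖γ k‖ < 1) :
    Summable fun t => ‖Phi γ d t‖ := by
  have hpow (k : ℕ) (hk : k ≤ d) : Summable fun t => ‖γ k ^ t‖ := by
    simpa only [norm_pow] using summable_geometric_of_lt_one (norm_nonneg _) (hγ k hk)
  induction d with
  | zero => simpa only [Phi_zero_left] using hpow 0 le_rfl
  | succ d ih =>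
    simp only [Phi_succ_left]
    exact summable_norm_sum_mul_antidiagonal_of_summable_norm
      (ih (fun k hk => hγ k (hk.trans d.le_succ)) fun k hk => hpow k (hk.trans d.le_succ))
      (hpow (d + 1) le_rfl)

section RowStochastic

variable {ι : Type*} [Fintype ι] {M : Matrix ι ι ℝ}

theorem norm_mulVec_le_of_row_stochastic (hM0 : ∀ i j, 0 ≤ M i j) (hM1 : ∀ i, ∑ j, M i j = 1)
    (v : ι → ℝ) : ‖M.mulVec v‖ ≤ ‖v‖ := by
  refine (pi_norm_le_iff_of_nonneg (norm_nonneg v)).2 fun i => ?_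
  calc ‖∑ j, M i j * v j‖ ≤ ∑ j, ‖M i j * v j‖ := norm_sum_le _ _
    _ ≤ ∑ j, M i j * ‖v‖ := by
        refine Finset.sum_le_sum fun j _ => ?_
        rw [norm_mul, Real.norm_of_nonneg (hM0 i j)]
        exact mul_le_mul_of_nonneg_left (norm_le_pi_norm v j) (hM0 i j)
    _ = ‖v‖ := by rw [← Finset.sum_mul, hM1, one_mul]

theorem norm_pow_mulVec_le_of_row_stochastic [DecidableEq ι] (hM0 : ∀ i j, 0 ≤ M i j)
    (hM1 : ∀ i, ∑ j, M i j = 1) (v : ι → ℝ) (t : ℕ) : ‖(M ^ t).mulVec v‖ ≤ ‖v‖ := by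
  induction t with
  | zero => simp
  | succ t ih =>
    rw [pow_succ', ← Matrix.mulVec_mulVec]
    exact (norm_mulVec_le_of_row_stochastic hM0 hM1 _).trans ih

theorem summable_norm_Phi_smul_pow_mulVec [DecidableEq ι] (hM0 : ∀ i j, 0 ≤ M i j)
    (hM1 : ∀ i, ∑ j, M i j = 1) (ρ : ι → ℝ) (γ : ℕ → ℝ) (d : ℕ) (hγ : ∀ k ≤ d, ‖γ k‖ < 1) :
    Summable fun t => ‖Phi γ d t • (M ^ t).mulVec ρ‖ := by
  refine ((summable_norm_Phi γ d hγ).mul_right ‖ρ‖).of_nonneg_of_le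
    (fun _ => norm_nonneg _) fun t => ?_
  rw [norm_smul]
  exact mul_le_mul_of_nonneg_left (norm_pow_mulVec_le_of_row_stochastic hM0 hM1 ρ t)
    (norm_nonneg _)

end RowStochastic

/-- The Bellman equation for the delayed value functions. -/
theorem eq_add_sum_smul_mulVec_of_hasSum_Phi {ι : Type*} [Fintype ι] [DecidableEq ι]
    {M : Matrix ι ι ℝ} {ρ : ι → ℝ} {γ : ℕ → ℝ} {V : ℕ → ι → ℝ} {D : ℕ}
    (hV : ∀ d ≤ D, HasSum (fun t => Phi γ d t • (M ^ t).mulVec ρ) (V d)) :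
    V D = ρ + ∑ d ∈ Finset.range (D + 1), γ d • M.mulVec (V d) := by
  have hshift : HasSum (fun t => Phi γ D (t + 1) • (M ^ (t + 1)).mulVec ρ)
      (∑ d ∈ Finset.range (D + 1), γ d • M.mulVec (V d)) := by
    have hsum : HasSum
        (fun t => ∑ d ∈ Finset.range (D + 1), γ d • M.mulVec (Phi γ d t • (M ^ t).mulVec ρ))
        (∑ d ∈ Finset.range (D + 1), γ d • M.mulVec (V d)) :=
      hasSum_sum fun d hd =>
        ((hV d (Finset.mem_range_succ_iff.1 hd)).map M.mulVecLin
          M.mulVecLin.continuous_of_finiteDimensional).const_smul (γ d)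
    refine hsum.congr_fun fun t => ?_
    simp only [Phi_succ_right, Finset.sum_smul, pow_succ', ← Matrix.mulVec_mulVec,
      Matrix.mulVec_smul, smul_smul]
  have h := (hasSum_nat_add_iff' 1).2 (hV D le_rfl)
  have heq := h.unique hshift
  simp only [Finset.sum_range_one, Phi_zero_right, pow_zero, Matrix.one_mulVec, one_smul] at heq
  rw [← heq, add_sub_cancel]

/-- Proposition 1, finite-state matrix form. For a row-stochastic matrix `M`,
reward vector `ρ` and discounts `γ_0,...,γ_D ∈ (0,1)`, the series defining the delayed value
functions `V_d = Σ_t Φ_d(t) M^t ρ` converge absolutely, and the affine Bellman operator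
`T(q) = ρ + Σ_{d<D} γ_d M V_d + γ_D M q` is a `γ_D`-contraction for the sup norm on `ℝ^n`
(the Pi norm on `Fin n → ℝ`) with `V_D` as its unique fixed point. -/
theorem stmt0 (n : ℕ) (hn : 1 ≤ n) (M : Matrix (Fin n) (Fin n) ℝ)
    (hM0 : ∀ i j, 0 ≤ M i j) (hM1 : ∀ i, ∑ j, M i j = 1)
    (ρ : Fin n → ℝ) (D : ℕ) (γ : ℕ → ℝ) (hγ : ∀ d ≤ D, 0 < γ d ∧ γ d < 1)
    (V : ℕ → (Fin n → ℝ)) (hV : ∀ d, V d = ∑' t : ℕ, Phi γ d t • (M ^ t).mulVec ρ)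
    (Tmap : (Fin n → ℝ) → (Fin n → ℝ))
    (hT : ∀ q, Tmap q = ρ + (∑ d ∈ Finset.range D, γ d • M.mulVec (V d)) + γ D • M.mulVec q) :
    (∀ d ≤ D, Summable fun t : ℕ => ‖Phi γ d t • (M ^ t).mulVec ρ‖) ∧
    LipschitzWith (γ D).toNNReal Tmap ∧
    Tmap (V D) = V D ∧
    (∀ q, Tmap q = q → q = V D) := by
  have hnorm (d : ℕ) (hd : d ≤ D) : ‖γ d‖ < 1 := by
    rw [Real.norm_of_nonneg (hγ d hd).1.le]
    exact (hγ d hd).2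
  have hsummable (d : ℕ) (hd : d ≤ D) : Summable fun t => ‖Phi γ d t • (M ^ t).mulVec ρ‖ :=
    summable_norm_Phi_smul_pow_mulVec hM0 hM1 ρ γ d fun k hk => hnorm k (hk.trans hd)
  have hlip : LipschitzWith (γ D).toNNReal Tmap := by
    refine LipschitzWith.of_dist_le_mul fun p q => ?_
    rw [Real.coe_toNNReal _ (hγ D le_rfl).1.le, dist_eq_norm, dist_eq_norm, hT, hT,
      add_sub_add_left_eq_sub, ← smul_sub, ← Matrix.mulVec_sub, norm_smul,
      Real.norm_of_nonneg (hγ D le_rfl).1.le]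
    exact mul_le_mul_of_nonneg_left (norm_mulVec_le_of_row_stochastic hM0 hM1 _)
      (hγ D le_rfl).1.le
  have hfix : Tmap (V D) = V D := by
    have hbellman := eq_add_sum_smul_mulVec_of_hasSum_Phi (γ := γ) (V := V) (D := D)
      fun d hd => by
        rw [hV d]
        exact (hsummable d hd).of_norm.hasSum
    rw [Finset.sum_range_succ, ← add_assoc] at hbellman
    rw [hT, ← hbellman]
  have hcontr : ContractingWith (γ D).toNNReal Tmap :=
    ⟨Real.toNNReal_lt_one.2 (hγ D le_rfl).2, hlip⟩
  exact ⟨hsummable, hlip, hfix, fun q hq => hcontr.fixedPoint_unique' hq hfix⟩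
end

section
/- Let γ_0, ..., γ_D be real numbers. Then for every integer t ≥ 1: Φ_D(t) = Σ_{d=0}^D γ_d Φ_d(t − 1). -/
/-- third equality of Lemma 1:
`Φ_D(t) = Σ_{d=0}^D γ_d Φ_d(t-1)` for `t ≥ 1`. -/
theorem stmt6 (γ : ℕ → ℝ) (D : ℕ) (t : ℕ) (ht : 1 ≤ t) :
    Phi γ D t = ∑ d ∈ Finset.range (D + 1), γ d * Phi γ d (t - 1) := by
  obtain ⟨s, rfl⟩ := Nat.exists_eq_add_of_le' ht
  rw [Nat.add_sub_cancel]
  induction D with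
  | zero => simp [Phi_zero_left, pow_succ']
  | succ D ih => rw [Phi_succ_succ, ih, ← Finset.sum_range_succ _ (D + 1)]
end

section
/- Let γ_0, ..., γ_D be real numbers and w ∈ ℝ^{D+1}. Then for all n, t ∈ ℕ: Σ_{d=0}^D w_d Φ_d(t + n) = Σ_{d=0}^D (Γ^n w)_d Φ_d(t); equivalently, with η(t) := Σ_{d=0}^D w_d Φ_d(t), one has η(t + n) = [f^n(η)](t) where [f^n(η)](t) := Σ_{d=0}^D (Γ^n w)_d Φ_d(t). -/
/-- `Gam γ D` is the (D+1)×(D+1) matrix with `Γ_{ij} = γ_i` if `i ≤ j`, else `0`. -/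
def Gam (γ : ℕ → ℝ) (D : ℕ) : Matrix (Fin (D + 1)) (Fin (D + 1)) ℝ :=
  Matrix.of fun i j => if i ≤ j then γ i else 0

/-- The complete homogeneous symmetric polynomial of degree `t` evaluated at `γ 0, …, γ (k - 1)`. -/
noncomputable def completeHomogeneous (γ : ℕ → ℝ) (k t : ℕ) : ℝ :=
  ∑ a ∈ Finset.Nat.antidiagonalTuple k t, ∏ i : Fin k, γ i ^ a i

theorem completeHomogeneous_succ_succ (γ : ℕ → ℝ) (k t : ℕ) :
    completeHomogeneous γ (k + 1) (t + 1) =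
      completeHomogeneous γ k (t + 1) + γ k * completeHomogeneous γ (k + 1) t := by
  unfold completeHomogeneous
  rw [← Finset.sum_filter_add_sum_filter_not _ (fun a => a (Fin.last k) = 0), Finset.mul_sum]
  congr 1
  · refine Finset.sum_bij' (fun a _ => Fin.init a) (fun b _ => Fin.snoc (α := fun _ => ℕ) b 0)
      ?_ ?_ ?_ ?_ ?_
    · intro a ha
      simp only [Finset.mem_filter, Finset.Nat.mem_antidiagonalTuple, Fin.sum_univ_castSucc] at ha
      simp only [Finset.Nat.mem_antidiagonalTuple, Fin.init]
      omega
    · intro b hb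
      simpa [Finset.Nat.mem_antidiagonalTuple, Fin.sum_univ_castSucc] using hb
    · intro a ha
      rw [← (Finset.mem_filter.mp ha).2, Fin.snoc_init_self]
    · intro b _
      simp
    · intro a ha
      simp [Fin.prod_univ_castSucc, (Finset.mem_filter.mp ha).2, Fin.init]
  · refine Finset.sum_bij' (fun a _ => Fin.snoc (α := fun _ => ℕ) (Fin.init a) (a (Fin.last k) - 1))
      (fun b _ => Fin.snoc (α := fun _ => ℕ) (Fin.init b) (b (Fin.last k) + 1)) ?_ ?_ ?_ ?_ ?_
    · intro a ha
      simp only [Finset.mem_filter, Finset.Nat.mem_antidiagonalTuple, Fin.sum_univ_castSucc] at ha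
      simp only [Finset.Nat.mem_antidiagonalTuple, Fin.sum_univ_castSucc, Fin.snoc_castSucc,
        Fin.snoc_last, Fin.init]
      omega
    · intro b hb
      simp only [Finset.Nat.mem_antidiagonalTuple, Fin.sum_univ_castSucc] at hb
      simp only [Finset.mem_filter, Finset.Nat.mem_antidiagonalTuple, Fin.sum_univ_castSucc,
        Fin.snoc_castSucc, Fin.snoc_last, Fin.init]
      omega
    · intro a ha
      have h := (Finset.mem_filter.mp ha).2
      simp [Nat.sub_add_cancel (Nat.pos_of_ne_zero h)]
    · intro b _
      simp
    · intro a ha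
      obtain ⟨m, hm⟩ := Nat.exists_eq_succ_of_ne_zero (Finset.mem_filter.mp ha).2
      simp [Fin.prod_univ_castSucc, hm, Fin.init, pow_succ]
      ring

theorem completeHomogeneous_succ (γ : ℕ → ℝ) (k t : ℕ) :
    completeHomogeneous γ k (t + 1) =
      ∑ i ∈ Finset.range k, γ i * completeHomogeneous γ (i + 1) t := by
  induction k with
  | zero => simp [completeHomogeneous]
  | succ k ih => rw [completeHomogeneous_succ_succ, ih, Finset.sum_range_succ]

theorem Phi_succ (γ : ℕ → ℝ) (d t : ℕ) :
    Phi γ d (t + 1) = ∑ i ∈ Finset.range (d + 1), γ i * Phi γ i t :=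
  completeHomogeneous_succ γ (d + 1) t

theorem Phi_succ_eq_sum_Gam (γ : ℕ → ℝ) (D : ℕ) (d : Fin (D + 1)) (t : ℕ) :
    Phi γ d (t + 1) = ∑ i, Gam γ D i d * Phi γ i t := by
  have h (i : Fin (D + 1)) : Gam γ D i d * Phi γ i t =
      if (i : ℕ) ∈ Finset.range (d + 1) then γ i * Phi γ i t else 0 := by
    simp [Gam, ite_mul]
  rw [Phi_succ, Finset.sum_congr rfl fun i _ => h i,
    Fin.sum_univ_eq_sum_range (fun i => if i ∈ Finset.range (d + 1 : ℕ) then γ i * Phi γ i t else 0),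
    Finset.sum_ite_mem, Finset.inter_eq_right.mpr (Finset.range_mono d.isLt)]

theorem sum_mul_Phi_succ (γ : ℕ → ℝ) (D : ℕ) (w : Fin (D + 1) → ℝ) (t : ℕ) :
    ∑ d : Fin (D + 1), w d * Phi γ d (t + 1) =
      ∑ d : Fin (D + 1), ((Gam γ D).mulVec w) d * Phi γ d t := by
  simp_rw [Phi_succ_eq_sum_Gam, Matrix.mulVec, dotProduct, Finset.mul_sum, Finset.sum_mul]
  rw [Finset.sum_comm]
  exact Finset.sum_congr rfl fun i _ => Finset.sum_congr rfl fun d _ => by ring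

/-- iterated form of `[f^n(η)](t) = ⟨Γ^n w, Φ(t)⟩`: for all `n, t ∈ ℕ`,
`Σ_{d=0}^D w_d Φ_d(t+n) = Σ_{d=0}^D (Γ^n w)_d Φ_d(t)`. -/
theorem stmt8 (γ : ℕ → ℝ) (D : ℕ) (w : Fin (D + 1) → ℝ) (n t : ℕ) :
    ∑ d : Fin (D + 1), w d * Phi γ d (t + n)
      = ∑ d : Fin (D + 1), ((Gam γ D ^ n).mulVec w) d * Phi γ d t := by
  induction n generalizing w with
  | zero => simp
  | succ n ih => rw [← add_assoc, sum_mul_Phi_succ, ih, Matrix.mulVec_mulVec, pow_succ]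
end

section
/- Let 0 < γ_D < γ_{D-1} < ... < γ_0 < 1 and let w ∈ ℝ^{D+1} have all components nonnegative with w ≠ 0. Then Γ^n w ≠ 0 for every n ∈ ℕ, and the normalized iterates Γ^n w / ‖Γ^n w‖ converge, as n → ∞, to the first standard basis vector e_0 = (1, 0, ..., 0), where ‖·‖ is the Euclidean norm on ℝ^{D+1}. -/
/-- Euclidean norm on `ℝ^m`. -/
noncomputable def eucNorm {m : ℕ} (v : Fin m → ℝ) : ℝ := Real.sqrt (∑ d, v d ^ 2)

open Filter Topology

theorem summable_of_succ_le_mul_add {x f : ℕ → ℝ} {q : ℝ} (hq0 : 0 ≤ q) (hq1 : q < 1)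
    (hx : ∀ n, 0 ≤ x n) (hf0 : ∀ n, 0 ≤ f n) (hf : Summable f)
    (h : ∀ n, x (n + 1) ≤ q * (x n + f n)) : Summable x := by
  refine summable_of_sum_range_le (c := (x 0 + q * ∑' n, f n) / (1 - q)) hx fun n => ?_
  rw [le_div_iff₀ (by linarith)]
  have hsucc := Finset.sum_range_succ' x n
  have hmono : ∑ k ∈ Finset.range n, x k ≤ ∑ k ∈ Finset.range (n + 1), x k := by
    rw [Finset.sum_range_succ]
    linarith [hx n]
  have hstep : ∑ k ∈ Finset.range n, x (k + 1)
      ≤ q * (∑ k ∈ Finset.range n, x k + ∑ k ∈ Finset.range n, f k) := by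
    rw [← Finset.sum_add_distrib, Finset.mul_sum]
    exact Finset.sum_le_sum fun k _ => h k
  have hfs := mul_le_mul_of_nonneg_left (hf.sum_le_tsum (Finset.range n) fun k _ => hf0 k) hq0
  linarith

theorem Gam_mulVec_apply (γ : ℕ → ℝ) (D : ℕ) (v : Fin (D + 1) → ℝ) (i : Fin (D + 1)) :
    (Gam γ D).mulVec v i = γ i * ∑ j ∈ Finset.Ici i, v j := by
  simp only [Gam, Matrix.mulVec, dotProduct, Matrix.of_apply, ite_mul, zero_mul,
    Finset.mul_sum]
  rw [← Finset.sum_filter]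
  congr 1
  ext j
  simp

theorem Gam_pow_succ_mulVec_apply (γ : ℕ → ℝ) (D n : ℕ) (w : Fin (D + 1) → ℝ)
    (i : Fin (D + 1)) :
    (Gam γ D ^ (n + 1)).mulVec w i = γ i * ∑ j ∈ Finset.Ici i, (Gam γ D ^ n).mulVec w j := by
  rw [pow_succ', ← Matrix.mulVec_mulVec, Gam_mulVec_apply]

theorem Gam_pow_mulVec_nonneg {γ : ℕ → ℝ} {D : ℕ} (hpos : ∀ d ≤ D, 0 < γ d)
    {w : Fin (D + 1) → ℝ} (hw : ∀ d, 0 ≤ w d) (n : ℕ) (i : Fin (D + 1)) :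
    0 ≤ (Gam γ D ^ n).mulVec w i := by
  induction n generalizing i with
  | zero => simpa using hw i
  | succ n ih =>
    rw [Gam_pow_succ_mulVec_apply]
    exact mul_nonneg (hpos i (by omega)).le (Finset.sum_nonneg fun j _ => ih j)

theorem pow_mul_sum_le_Gam_pow_succ_mulVec_zero {γ : ℕ → ℝ} {D : ℕ}
    (hpos : ∀ d ≤ D, 0 < γ d) {w : Fin (D + 1) → ℝ} (hw : ∀ d, 0 ≤ w d) (n : ℕ) :
    γ 0 ^ (n + 1) * ∑ j, w j ≤ (Gam γ D ^ (n + 1)).mulVec w 0 := by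
  induction n with
  | zero =>
    rw [Gam_pow_succ_mulVec_apply]
    have hIci : Finset.Ici (0 : Fin (D + 1)) = Finset.univ := by ext; simp
    simp [hIci]
  | succ n ih =>
    rw [Gam_pow_succ_mulVec_apply, pow_succ', mul_assoc]
    refine mul_le_mul_of_nonneg_left (ih.trans ?_) (hpos 0 (by omega)).le
    exact Finset.single_le_sum (f := (Gam γ D ^ (n + 1)).mulVec w)
      (fun j _ => Gam_pow_mulVec_nonneg hpos hw _ j) (by simp)

theorem summable_Gam_pow_mulVec_div_pow {γ : ℕ → ℝ} {D : ℕ} (hpos : ∀ d ≤ D, 0 < γ d)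
    (hmono : ∀ i j, i < j → j ≤ D → γ j < γ i) {w : Fin (D + 1) → ℝ} (hw : ∀ d, 0 ≤ w d)
    (i : Fin (D + 1)) (hi : 0 < i) :
    Summable fun n => (Gam γ D ^ n).mulVec w i / γ 0 ^ n := by
  have h0 : 0 < γ 0 := hpos 0 (by omega)
  have hnn (n : ℕ) (j : Fin (D + 1)) : 0 ≤ (Gam γ D ^ n).mulVec w j / γ 0 ^ n :=
    div_nonneg (Gam_pow_mulVec_nonneg hpos hw n j) (by positivity)
  induction i using WellFoundedGT.induction with
  | ind i ih =>
    refine summable_of_succ_le_mul_add (q := γ i / γ 0)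
      (f := fun n => ∑ j ∈ Finset.Ioi i, (Gam γ D ^ n).mulVec w j / γ 0 ^ n)
      (div_nonneg (hpos i (by omega)).le h0.le)
      ((div_lt_one h0).2 (hmono 0 i hi (by omega))) (fun n => hnn n i)
      (fun n => Finset.sum_nonneg fun j _ => hnn n j)
      (summable_sum fun j hj => ih j (Finset.mem_Ioi.1 hj) (hi.trans (Finset.mem_Ioi.1 hj)))
      fun n => le_of_eq ?_
    rw [Gam_pow_succ_mulVec_apply, ← Finset.sum_div, ← Finset.Ioi_insert,
      Finset.sum_insert (by simp)]
    field_simp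
    ring

theorem eucNorm_pos {m : ℕ} {v : Fin m → ℝ} {i : Fin m} (h : 0 < v i) : 0 < eucNorm v :=
  Real.sqrt_pos.2 <| Finset.sum_pos' (fun _ _ => sq_nonneg _) ⟨i, Finset.mem_univ i, by positivity⟩

theorem le_eucNorm {m : ℕ} (v : Fin m → ℝ) (i : Fin m) : v i ≤ eucNorm v :=
  Real.le_sqrt_of_sq_le <|
    Finset.single_le_sum (f := fun d => v d ^ 2) (fun _ _ => sq_nonneg _) (Finset.mem_univ i)

theorem sum_sq_inv_eucNorm_smul {m : ℕ} {v : Fin m → ℝ} (h : 0 < eucNorm v) :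
    ∑ i, ((eucNorm v)⁻¹ • v) i ^ 2 = 1 := by
  have hsq : eucNorm v ^ 2 = ∑ i, v i ^ 2 :=
    Real.sq_sqrt (Finset.sum_nonneg fun _ _ => sq_nonneg _)
  simp only [Pi.smul_apply, smul_eq_mul, mul_pow, ← Finset.mul_sum, ← hsq]
  field_simp

theorem tendsto_single_zero_of_sum_sq_eq_one {D : ℕ} {p : ℕ → Fin (D + 1) → ℝ}
    (h0 : ∀ᶠ n in atTop, 0 ≤ p n 0) (h1 : ∀ᶠ n in atTop, ∑ i, p n i ^ 2 = 1)
    (h : ∀ i, 0 < i → Tendsto (fun n => p n i) atTop (𝓝 0)) :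
    Tendsto p atTop (𝓝 (Pi.single 0 1)) := by
  refine tendsto_pi_nhds.2 fun i => ?_
  rcases eq_or_ne i 0 with rfl | hi
  · have hlim : Tendsto (fun n => √(1 - ∑ i : Fin D, p n i.succ ^ 2)) atTop
        (𝓝 √(1 - ∑ _i : Fin D, (0 : ℝ) ^ 2)) :=
      (tendsto_const_nhds.sub
        (tendsto_finsetSum _ fun i _ => (h i.succ i.succ_pos).pow 2)).sqrt
    have hone : √(1 - ∑ _i : Fin D, (0 : ℝ) ^ 2) = 1 := by simp
    rw [hone] at hlim
    rw [Pi.single_eq_same]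
    refine hlim.congr' ?_
    filter_upwards [h0, h1] with n hn0 hn1
    rw [Fin.sum_univ_succ] at hn1
    rw [← hn1, add_sub_cancel_right, Real.sqrt_sq hn0]
  · rw [Pi.single_eq_of_ne hi]
    exact h i (Fin.pos_of_ne_zero hi)

/-- power-iteration convergence, Equation (bellman_asymptotic): if
`0 < γ_D < ... < γ_0 < 1` and `w` is nonnegative and nonzero, then `Γ^n w ≠ 0` for all `n` and
the normalized iterates `Γ^n w / ‖Γ^n w‖` (Euclidean norm) converge to `e_0 = (1,0,...,0)`. -/
theorem stmt12 (D : ℕ) (γ : ℕ → ℝ)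
    (hpos : ∀ d ≤ D, 0 < γ d) (hlt : γ 0 < 1)
    (hmono : ∀ i j, i < j → j ≤ D → γ j < γ i)
    (w : Fin (D + 1) → ℝ) (hw : ∀ d, 0 ≤ w d) (hw0 : w ≠ 0) :
    (∀ n : ℕ, (Gam γ D ^ n).mulVec w ≠ 0) ∧
    Filter.Tendsto
      (fun n : ℕ => (eucNorm ((Gam γ D ^ n).mulVec w))⁻¹ • (Gam γ D ^ n).mulVec w)
      Filter.atTop
      (nhds (Pi.single (0 : Fin (D + 1)) (1 : ℝ) : Fin (D + 1) → ℝ)) := by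
  have hγ : 0 < γ 0 := hpos 0 (by omega)
  have hs : 0 < ∑ j, w j := by
    obtain ⟨i, hi⟩ := Function.ne_iff.1 hw0
    exact Finset.sum_pos' (fun j _ => hw j)
      ⟨i, Finset.mem_univ i, lt_of_le_of_ne (hw i) (Ne.symm hi)⟩
  have hlow (n : ℕ) (hn : 1 ≤ n) : γ 0 ^ n * ∑ j, w j ≤ (Gam γ D ^ n).mulVec w 0 := by
    obtain ⟨k, rfl⟩ := Nat.exists_eq_add_of_le' hn
    exact pow_mul_sum_le_Gam_pow_succ_mulVec_zero hpos hw k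
  have hv0 (n : ℕ) (hn : 1 ≤ n) : 0 < (Gam γ D ^ n).mulVec w 0 :=
    (by positivity : 0 < γ 0 ^ n * ∑ j, w j).trans_le (hlow n hn)
  have hnn := Gam_pow_mulVec_nonneg hpos hw
  refine ⟨fun n => ?_, tendsto_single_zero_of_sum_sq_eq_one ?_ ?_ fun i hi => ?_⟩
  · rcases Nat.eq_zero_or_pos n with rfl | hn
    · simpa using hw0
    · intro h
      simpa [h] using hv0 n hn
  · filter_upwards with n
    exact mul_nonneg (inv_nonneg.2 (Real.sqrt_nonneg _)) (hnn n 0)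
  · filter_upwards [eventually_ge_atTop 1] with n hn
    exact sum_sq_inv_eucNorm_smul (eucNorm_pos (hv0 n hn))
  · have hlim :=
      (summable_Gam_pow_mulVec_div_pow hpos hmono hw i hi).tendsto_atTop_zero.div_const (∑ j, w j)
    rw [zero_div] at hlim
    refine squeeze_zero' ?_ ?_ hlim
    · filter_upwards with n
      exact mul_nonneg (inv_nonneg.2 (Real.sqrt_nonneg _)) (hnn n i)
    · filter_upwards [eventually_ge_atTop 1] with n hn
      rw [Pi.smul_apply, smul_eq_mul, inv_mul_eq_div, div_div]
      exact div_le_div_of_nonneg_left (hnn n i) (by positivity)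
        ((hlow n hn).trans (le_eucNorm _ 0))
end
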